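/- arXiv:1708.04832 — 2 statements merged into one kernel-verified Lean document; each statement's English description precedes it below -/
import Mathlib

section
/- For any compatible metric d on X^Γ, the generalized shift dynamical system (X^Γ, σ_φ) is uniform distributional chaotic if and only if φ : Γ → Γ has at least one non-quasi-periodic point. -/
open Filter Topology

/-- `d : Y → Y → ℝ` is a metric on the topological space `Y` compatible with
(i.e. inducing) its topology. -/
def IsCompatibleMetric (Y : Type*) [t : TopologicalSpace Y] (d : Y → Y → ℝ) : Prop :=
  ∃ m : MetricSpace Y, m.toUniformSpace.toTopologicalSpace = t ∧ ∀ a b, m.dist a b = d a b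

/-- The generalized shift `σ_φ : X^Γ → X^Γ`, `σ_φ((x_α)_α) = (x_{φ(α)})_α`. -/
def genShift {X Γ : Type*} (φ : Γ → Γ) (x : Γ → X) : Γ → X := fun α => x (φ α)

/-- `θ` is a quasi-periodic point of `φ` iff its forward orbit `{φ^n(θ) : n ≥ 0}` is finite. -/
def QuasiPeriodic {Γ : Type*} (φ : Γ → Γ) (θ : Γ) : Prop :=
  (Set.range fun n : ℕ => φ^[n] θ).Finite

/-- `θ` is a periodic point of `φ` iff `φ^n(θ) = θ` for some `n ≥ 1`. -/
def PeriodicPt {Γ : Type*} (φ : Γ → Γ) (θ : Γ) : Prop := ∃ n ≥ 1, φ^[n] θ = θ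

/-- `ξ(x,y,t,n) = #{i ∈ {0,…,n−1} : d(f^i(x), f^i(y)) < t}`. -/
noncomputable def xiCount {Y : Type*} (d : Y → Y → ℝ) (f : Y → Y) (x y : Y) (t : ℝ) (n : ℕ) :
    ℕ :=
  {i : ℕ | i < n ∧ d (f^[i] x) (f^[i] y) < t}.ncard

/-- `F_{xy}(t) = liminf_n ξ(x,y,t,n)/n`. -/
noncomputable def Fdist {Y : Type*} (d : Y → Y → ℝ) (f : Y → Y) (x y : Y) (t : ℝ) : ℝ :=
  liminf (fun n : ℕ => (xiCount d f x y t n : ℝ) / n) atTop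

/-- `F*_{xy}(t) = limsup_n ξ(x,y,t,n)/n`. -/
noncomputable def FdistStar {Y : Type*} (d : Y → Y → ℝ) (f : Y → Y) (x y : Y) (t : ℝ) : ℝ :=
  limsup (fun n : ℕ => (xiCount d f x y t n : ℝ) / n) atTop

/-- `ζ(x,y,γ_D,n) = #{i ∈ {0,…,n−1} : (f^i(x), f^i(y)) ∈ γ_D}` where
`γ_D = {(u,v) : u_α = v_α for all α ∈ D}`. -/
noncomputable def zetaCount {X Γ : Type*} (f : (Γ → X) → (Γ → X)) (x y : Γ → X) (D : Set Γ)
    (n : ℕ) : ℕ :=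
  {i : ℕ | i < n ∧ ∀ α ∈ D, f^[i] x α = f^[i] y α}.ncard

/-- `G_{xy}(γ_D) = liminf_n ζ(x,y,γ_D,n)/n`. -/
noncomputable def Gdist {X Γ : Type*} (f : (Γ → X) → (Γ → X)) (x y : Γ → X) (D : Set Γ) : ℝ :=
  liminf (fun n : ℕ => (zetaCount f x y D n : ℝ) / n) atTop

/-- `G*_{xy}(γ_D) = limsup_n ζ(x,y,γ_D,n)/n`. -/
noncomputable def GdistStar {X Γ : Type*} (f : (Γ → X) → (Γ → X)) (x y : Γ → X) (D : Set Γ) :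
    ℝ :=
  limsup (fun n : ℕ => (zetaCount f x y D n : ℝ) / n) atTop

/-- `x, y` are distributionally scrambled of type 1 (w.r.t. the metric `d` and the map `f`). -/
def DistScrambled1 {Y : Type*} (d : Y → Y → ℝ) (f : Y → Y) (x y : Y) : Prop :=
  (∃ s > 0, Fdist d f x y s = 0) ∧ ∀ s > 0, FdistStar d f x y s = 1

/-- `x, y` are distributionally scrambled of type 2. -/
def DistScrambled2 {Y : Type*} (d : Y → Y → ℝ) (f : Y → Y) (x y : Y) : Prop :=
  (∃ s > 0, Fdist d f x y s < 1) ∧ ∀ s > 0, FdistStar d f x y s = 1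

/-- `x, y` are distributionally scrambled of type 3. -/
def DistScrambled3 {Y : Type*} (d : Y → Y → ℝ) (f : Y → Y) (x y : Y) : Prop :=
  ∃ a b : ℝ, 0 < a ∧ a < b ∧ ∀ s ∈ Set.Icc a b, Fdist d f x y s < FdistStar d f x y s

/-- `A` is a distributionally scrambled set of type 1: it has at least two elements and all
pairs of distinct points of `A` are distributionally scrambled of type 1. -/
def DistScrambledSet1 {Y : Type*} (d : Y → Y → ℝ) (f : Y → Y) (A : Set Y) : Prop :=
  A.Nontrivial ∧ ∀ x ∈ A, ∀ y ∈ A, x ≠ y → DistScrambled1 d f x y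

/-- `A` is a distributionally scrambled set of type 2. -/
def DistScrambledSet2 {Y : Type*} (d : Y → Y → ℝ) (f : Y → Y) (A : Set Y) : Prop :=
  A.Nontrivial ∧ ∀ x ∈ A, ∀ y ∈ A, x ≠ y → DistScrambled2 d f x y

/-- `A` is a distributionally scrambled set of type 3. -/
def DistScrambledSet3 {Y : Type*} (d : Y → Y → ℝ) (f : Y → Y) (A : Set Y) : Prop :=
  A.Nontrivial ∧ ∀ x ∈ A, ∀ y ∈ A, x ≠ y → DistScrambled3 d f x y

/-- `(Y,f)` is uniform distributionally chaotic: there is an uncountable distributionally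
scrambled set `A` of type 1 and a single `ε > 0` with `F_{xy}(ε) = 0` for distinct `x,y ∈ A`. -/
def UniformDC {Y : Type*} (d : Y → Y → ℝ) (f : Y → Y) : Prop :=
  ∃ A : Set Y, ¬ A.Countable ∧ DistScrambledSet1 d f A ∧
    ∃ ε > 0, ∀ x ∈ A, ∀ y ∈ A, x ≠ y → Fdist d f x y ε = 0

/-- `a` is a transitive point of `f`: its forward orbit is dense. -/
def TransitivePoint {Y : Type*} [TopologicalSpace Y] (f : Y → Y) (a : Y) : Prop :=
  Dense (Set.range fun n : ℕ => f^[n] a)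

/-- `(Y,f)` is dense distributionally chaotic: uniform distributional chaos witnessed by a
dense set. -/
def DenseDC {Y : Type*} [TopologicalSpace Y] (d : Y → Y → ℝ) (f : Y → Y) : Prop :=
  ∃ A : Set Y, ¬ A.Countable ∧ Dense A ∧ DistScrambledSet1 d f A ∧
    ∃ ε > 0, ∀ x ∈ A, ∀ y ∈ A, x ≠ y → Fdist d f x y ε = 0

/-- `(Y,f)` is transitive distributionally chaotic: uniform distributional chaos witnessed by a
dense set of transitive points. -/
def TransitiveDC {Y : Type*} [TopologicalSpace Y] (d : Y → Y → ℝ) (f : Y → Y) : Prop :=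
  ∃ A : Set Y, ¬ A.Countable ∧ Dense A ∧ (∀ a ∈ A, TransitivePoint f a) ∧
    DistScrambledSet1 d f A ∧
    ∃ ε > 0, ∀ x ∈ A, ∀ y ∈ A, x ≠ y → Fdist d f x y ε = 0

/-- The ω-limit set of `a` under `f`: all limits of `f^[n k] a` along strictly increasing
sequences `n`. -/
def OmegaSet {Y : Type*} [TopologicalSpace Y] (f : Y → Y) (a : Y) : Set Y :=
  {z | ∃ n : ℕ → ℕ, StrictMono n ∧ Tendsto (fun k => f^[n k] a) atTop (nhds z)}

/-- The set of periodic points of `f`. -/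
def PerSet {Y : Type*} (f : Y → Y) : Set Y := {y | ∃ n ≥ 1, f^[n] y = y}

/-- `x, y` are `ω^u`-scrambled. -/
def OmegaUScrambled {Y : Type*} [TopologicalSpace Y] (f : Y → Y) (x y : Y) : Prop :=
  ¬ (OmegaSet f x \ OmegaSet f y).Countable ∧
    (OmegaSet f x ∩ OmegaSet f y).Nonempty ∧ (OmegaSet f x \ PerSet f).Nonempty

/-- `x, y` are `ω^∞`-scrambled. -/
def OmegaInfScrambled {Y : Type*} [TopologicalSpace Y] (f : Y → Y) (x y : Y) : Prop :=
  (OmegaSet f x \ OmegaSet f y).Infinite ∧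
    (OmegaSet f x ∩ OmegaSet f y).Nonempty ∧ (OmegaSet f x \ PerSet f).Nonempty

/-- `A` is an `ω^u`-scrambled set. -/
def OmegaUScrambledSet {Y : Type*} [TopologicalSpace Y] (f : Y → Y) (A : Set Y) : Prop :=
  A.Nontrivial ∧ ∀ x ∈ A, ∀ y ∈ A, x ≠ y → OmegaUScrambled f x y

/-- `A` is an `ω^∞`-scrambled set. -/
def OmegaInfScrambledSet {Y : Type*} [TopologicalSpace Y] (f : Y → Y) (A : Set Y) : Prop :=
  A.Nontrivial ∧ ∀ x ∈ A, ∀ y ∈ A, x ≠ y → OmegaInfScrambled f x y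


section CompatibleMetric

variable {Y : Type*} [TopologicalSpace Y] {d : Y → Y → ℝ}

lemma IsCompatibleMetric.eq_zero_iff (hd : IsCompatibleMetric Y d) {a b : Y} :
    d a b = 0 ↔ a = b := by
  obtain ⟨m, rfl, hd⟩ := hd
  rw [← hd]
  exact dist_eq_zero

lemma IsCompatibleMetric.nonneg (hd : IsCompatibleMetric Y d) (a b : Y) : 0 ≤ d a b := by
  obtain ⟨m, rfl, hd⟩ := hd
  rw [← hd]
  exact dist_nonneg

lemma IsCompatibleMetric.continuous (hd : IsCompatibleMetric Y d) :
    Continuous fun p : Y × Y => d p.1 p.2 := by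
  obtain ⟨m, rfl, hd⟩ := hd
  simp only [← hd]
  exact continuous_dist

end CompatibleMetric

section Product

variable {X Γ : Type*} [TopologicalSpace X] [DiscreteTopology X]

lemma isClopen_setOf_agree (α : Γ) : IsClopen {p : (Γ → X) × (Γ → X) | p.1 α = p.2 α} :=
  (isClopen_discrete {q : X × X | q.1 = q.2}).preimage
    (f := fun p : (Γ → X) × (Γ → X) => (p.1 α, p.2 α)) (by fun_prop)

variable [Finite X] {d : (Γ → X) → (Γ → X) → ℝ}

/-- Points that are close for a compatible metric agree on a given finite set of coordinates. -/
lemma IsCompatibleMetric.exists_forall_agree (hd : IsCompatibleMetric (Γ → X) d) {D : Set Γ}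
    (hD : D.Finite) : ∃ ε > 0, ∀ u v, d u v < ε → ∀ α ∈ D, u α = v α := by
  have hclosed : IsClosed {p : (Γ → X) × (Γ → X) | ∃ α ∈ D, p.1 α ≠ p.2 α} := by
    have : {p : (Γ → X) × (Γ → X) | ∃ α ∈ D, p.1 α ≠ p.2 α} =
        ⋃ α ∈ D, {p : (Γ → X) × (Γ → X) | p.1 α = p.2 α}ᶜ := by
      ext p; simp
    rw [this]
    exact hD.isClosed_biUnion fun α _ => (isClopen_setOf_agree α).compl.isClosed
  rcases Set.eq_empty_or_nonempty {p : (Γ → X) × (Γ → X) | ∃ α ∈ D, p.1 α ≠ p.2 α} with h | h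
  · refine ⟨1, one_pos, fun u v _ α hα => by_contra fun hne => ?_⟩
    exact (Set.eq_empty_iff_forall_notMem.mp h (u, v)) ⟨α, hα, hne⟩
  · obtain ⟨p, ⟨β, -, hβ⟩, hmin⟩ :=
      hclosed.isCompact.exists_isMinOn h hd.continuous.continuousOn
    refine ⟨d p.1 p.2, (hd.nonneg _ _).lt_of_ne fun h0 => ?_, fun u v huv α hα => ?_⟩
    · exact hβ (by rw [hd.eq_zero_iff.mp h0.symm])
    · by_contra hne
      exact huv.not_ge (hmin (a := (u, v)) ⟨α, hα, hne⟩)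

/-- Points that agree on a large enough finite set of coordinates are close for a compatible
metric. -/
lemma IsCompatibleMetric.exists_finset_agree (hd : IsCompatibleMetric (Γ → X) d) {s : ℝ}
    (hs : 0 < s) : ∃ D : Finset Γ, ∀ u v, (∀ α ∈ D, u α = v α) → d u v < s := by
  classical
  obtain ⟨D, hD⟩ := exists_subset_nhds_of_compactSpace
    (V := fun D : Finset Γ => {p : (Γ → X) × (Γ → X) | ∀ α ∈ D, p.1 α = p.2 α})
    (U := {p | d p.1 p.2 < s})
    (fun D E => ⟨D ∪ E, fun p hp α hα => hp α (Finset.mem_union_left _ hα),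
      fun p hp α hα => hp α (Finset.mem_union_right _ hα)⟩)
    (fun D => by
      simp only [Set.ofPred_forall]
      exact isClosed_biInter fun α _ => (isClopen_setOf_agree α).isClosed)
    (fun p hp => by
      refine (isOpen_lt hd.continuous continuous_const).mem_nhds ?_
      have : p.1 = p.2 := funext fun α => Set.mem_iInter.mp hp {α} α (Finset.mem_singleton_self α)
      rwa [Set.mem_ofPred_eq, hd.eq_zero_iff.mpr this])
  exact ⟨D, fun u v h => hD (a := (u, v)) h⟩

end Product

section Frequency

variable {Y : Type*} {d : Y → Y → ℝ} {f : Y → Y} {x y : Y} {t : ℝ}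

lemma finite_setOf_lt_and (n : ℕ) (P : ℕ → Prop) : {i | i < n ∧ P i}.Finite :=
  (Set.finite_lt_nat n).subset fun _ hi => hi.1

lemma xiCount_le_of_forall {M N : ℕ}
    (h : ∀ i, M ≤ i → i < N → ¬ d (f^[i] x) (f^[i] y) < t) : xiCount d f x y t N ≤ M := by
  refine (Set.ncard_le_ncard (t := Set.Iio M) (fun i hi => ?_) (Set.finite_Iio M)).trans_eq ?_
  · exact not_le.mp fun hMi => h i hMi hi.1 hi.2
  · simp

lemma sub_le_xiCount_of_forall {a b N : ℕ} (hb : b ≤ N)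
    (h : ∀ i, a ≤ i → i < b → d (f^[i] x) (f^[i] y) < t) : b - a ≤ xiCount d f x y t N := by
  refine le_trans (by simp) (Set.ncard_le_ncard (s := Set.Ico a b)
    (fun i hi => ⟨hi.2.trans_le hb, h i hi.1 hi.2⟩) (finite_setOf_lt_and N _))

lemma xiCount_div_nonneg (n : ℕ) : 0 ≤ (xiCount d f x y t n : ℝ) / n := by positivity

lemma xiCount_div_le_one (n : ℕ) : (xiCount d f x y t n : ℝ) / n ≤ 1 := by
  refine div_le_one_of_le₀ (Nat.cast_le.mpr ?_) n.cast_nonneg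
  exact xiCount_le_of_forall fun i hi hi' => absurd hi' hi.not_gt

lemma isBoundedUnder_ge_xiCount_div :
    IsBoundedUnder (· ≥ ·) atTop fun n : ℕ => (xiCount d f x y t n : ℝ) / n :=
  isBoundedUnder_of ⟨0, xiCount_div_nonneg⟩

lemma isBoundedUnder_le_xiCount_div :
    IsBoundedUnder (· ≤ ·) atTop fun n : ℕ => (xiCount d f x y t n : ℝ) / n :=
  isBoundedUnder_of ⟨1, xiCount_div_le_one⟩

lemma Fdist_eq_zero_of_frequently
    (h : ∀ δ > 0, ∃ᶠ n : ℕ in atTop, (xiCount d f x y t n : ℝ) ≤ δ * n) :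
    Fdist d f x y t = 0 := by
  apply le_antisymm
  · refine le_of_forall_pos_le_add fun δ hδ => ?_
    rw [zero_add]
    exact liminf_le_of_frequently_le
      ((h δ hδ).mono fun n hn => div_le_of_le_mul₀ n.cast_nonneg hδ.le hn)
      isBoundedUnder_ge_xiCount_div
  · exact le_liminf_of_le isBoundedUnder_le_xiCount_div.isCoboundedUnder_ge
      (Eventually.of_forall xiCount_div_nonneg)

lemma FdistStar_eq_one_of_frequently
    (h : ∀ δ > 0, ∃ᶠ n : ℕ in atTop, (1 - δ) * n ≤ (xiCount d f x y t n : ℝ)) :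
    FdistStar d f x y t = 1 := by
  apply le_antisymm
  · exact limsup_le_of_le isBoundedUnder_ge_xiCount_div.isCoboundedUnder_le
      (Eventually.of_forall xiCount_div_le_one)
  · refine le_of_forall_pos_sub_le fun δ hδ => ?_
    refine le_limsup_of_frequently_le (((h δ hδ).and_eventually (eventually_gt_atTop 0)).mono ?_)
      isBoundedUnder_le_xiCount_div
    rintro n ⟨hn, hpos⟩
    exact (le_div_iff₀ (Nat.cast_pos.mpr hpos)).mpr hn

lemma Fdist_eq_one_of_forall_ge {M : ℕ} (h : ∀ i ≥ M, d (f^[i] x) (f^[i] y) < t) :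
    Fdist d f x y t = 1 := by
  refine Tendsto.liminf_eq (tendsto_of_tendsto_of_tendsto_of_le_of_le'
    (g := fun n : ℕ => 1 - (M : ℝ) / n) ?_ tendsto_const_nhds ?_
    (Eventually.of_forall xiCount_div_le_one))
  · simpa using tendsto_const_nhds.sub (tendsto_const_div_atTop_nhds_zero_nat (M : ℝ))
  · filter_upwards [eventually_gt_atTop 0] with n hn
    have hn' : (0 : ℝ) < n := Nat.cast_pos.mpr hn
    rw [one_sub_div hn'.ne']
    gcongr
    rw [sub_le_iff_le_add]
    have := sub_le_xiCount_of_forall (d := d) (f := f) (x := x) (y := y) (t := t) (le_refl n)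
      fun i (hi : M ≤ i) _ => h i hi
    exact_mod_cast Nat.sub_le_iff_le_add.mp this

lemma exists_lt_of_FdistStar_ne_zero (h : FdistStar d f x y t ≠ 0) :
    ∃ i, d (f^[i] x) (f^[i] y) < t := by
  by_contra! hge
  refine h ?_
  have h0 (n : ℕ) : xiCount d f x y t n = 0 :=
    Nat.le_zero.mp (xiCount_le_of_forall fun i _ _ => (hge i).not_gt)
  simp [FdistStar, h0]

end Frequency

section BlockLabel

/-- A labelling of `ℕ` that is constant on each block `[2 ^ 2 ^ k, 2 ^ 2 ^ (k + 1))` and takes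
each value on infinitely many blocks. -/
def blockLabel (n : ℕ) : ℕ := (Nat.log 2 (Nat.log 2 n)).unpair.1

lemma log_log_eq {k n : ℕ} (h : 2 ^ 2 ^ k ≤ n) (h' : n < 2 ^ 2 ^ (k + 1)) :
    Nat.log 2 (Nat.log 2 n) = k := by
  have hn : n ≠ 0 := ((by positivity : 0 < 2 ^ 2 ^ k).trans_le h).ne'
  have h1 : 2 ^ k ≤ Nat.log 2 n := Nat.le_log_of_pow_le one_lt_two h
  have h2 : Nat.log 2 n < 2 ^ (k + 1) := Nat.log_lt_of_lt_pow hn h'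
  exact Nat.log_eq_of_pow_le_of_lt_pow h1 h2

lemma eventually_add_le_mul_two_pow (C : ℝ) (hC : 0 ≤ C) {δ : ℝ} (hδ : 0 < δ) :
    ∀ᶠ k : ℕ in atTop, (2 : ℝ) ^ 2 ^ k + C ≤ δ * 2 ^ 2 ^ (k + 1) := by
  have hlim : Tendsto (fun k : ℕ => (2 : ℝ) ^ 2 ^ k) atTop atTop :=
    (tendsto_pow_atTop_atTop_of_one_lt one_lt_two).comp
      (tendsto_pow_atTop_atTop_of_one_lt one_lt_two)
  filter_upwards [hlim.eventually_ge_atTop ((1 + C) / δ)] with k hk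
  have h1 : (1 : ℝ) ≤ 2 ^ 2 ^ k := one_le_pow₀ one_le_two
  rw [div_le_iff₀ hδ] at hk
  rw [pow_succ 2 k, pow_mul]
  nlinarith

lemma frequently_block (m C : ℕ) {δ : ℝ} (hδ : 0 < δ) :
    ∃ᶠ N : ℕ in atTop, ∃ M : ℕ, (M : ℝ) + C ≤ δ * N ∧
      ∀ n, M ≤ n → n < N → blockLabel n = m := by
  obtain ⟨K, hK⟩ := eventually_atTop.mp
    (eventually_add_le_mul_two_pow C C.cast_nonneg hδ)
  refine frequently_atTop.mpr fun B => ?_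
  have hk := Nat.right_le_pair m (max K B)
  set k := Nat.pair m (max K B) with hkdef
  refine ⟨2 ^ 2 ^ (k + 1), ?_, 2 ^ 2 ^ k, ?_, fun n h h' => ?_⟩
  · calc B ≤ k + 1 := by omega
      _ ≤ 2 ^ (k + 1) := Nat.lt_two_pow_self.le
      _ ≤ 2 ^ 2 ^ (k + 1) := Nat.lt_two_pow_self.le
  · exact_mod_cast hK k (by omega)
  · rw [blockLabel, log_log_eq h h', hkdef, Nat.unpair_pair]

end BlockLabel

section GenShift

variable {X Γ : Type*} {φ : Γ → Γ}

lemma genShift_iterate_apply (n : ℕ) (x : Γ → X) (α : Γ) :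
    (genShift φ)^[n] x α = x (φ^[n] α) := by
  induction n generalizing x with
  | zero => rfl
  | succ n ih =>
    rw [Function.iterate_succ_apply, ih, genShift, Function.iterate_succ_apply']

lemma injective_iterate_of_not_quasiPeriodic {θ : Γ} (h : ¬ QuasiPeriodic φ θ) :
    Function.Injective fun n : ℕ => φ^[n] θ := by
  intro i j heq
  by_contra hne
  wlog hij : i < j generalizing i j
  · exact this heq.symm (Ne.symm hne) (by omega)
  refine h ?_
  refine ((Set.finite_Iio j).image fun n => φ^[n] θ).subset ?_
  rintro _ ⟨n, rfl⟩
  induction n using Nat.strong_induction_on with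
  | _ n ih =>
    rcases lt_or_ge n j with hn | hn
    · exact ⟨n, hn, rfl⟩
    · have : φ^[n] θ = φ^[n - j + i] θ := by
        have heq' : φ^[i] θ = φ^[j] θ := heq
        rw [Function.iterate_add_apply, heq', ← Function.iterate_add_apply, Nat.sub_add_cancel hn]
      simpa only [this] using ih (n - j + i) (by omega)

/-- If every point is quasi-periodic, then every finite `D` is contained in a finite invariant set
`E`, so that agreement on `E` at some time forces agreement on `D` at all later times. -/
lemma exists_finite_agree_of_quasiPeriodic (h : ∀ α, QuasiPeriodic φ α) (D : Finset Γ) :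
    ∃ E : Set Γ, E.Finite ∧ ∀ (x y : Γ → X) (i : ℕ),
      (∀ α ∈ E, (genShift φ)^[i] x α = (genShift φ)^[i] y α) →
        ∀ j ≥ i, ∀ α ∈ D, (genShift φ)^[j] x α = (genShift φ)^[j] y α := by
  refine ⟨⋃ α ∈ D, Set.range fun n : ℕ => φ^[n] α,
    D.finite_toSet.biUnion fun α _ => h α, fun x y i hi j hj α hα => ?_⟩
  have := hi (φ^[j - i] α) (Set.mem_biUnion hα ⟨j - i, rfl⟩)
  simpa only [genShift_iterate_apply, ← Function.iterate_add_apply, Nat.add_sub_cancel' hj]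
    using this

/-- If the orbit of `α` meets the injective orbit of `θ`, the meeting times differ by a constant. -/
lemma exists_le_add_of_iterate_eq {θ : Γ} (hθ : Function.Injective fun n : ℕ => φ^[n] θ) (α : Γ) :
    ∃ c : ℕ, ∀ i n : ℕ, φ^[n] θ = φ^[i] α → n ≤ i + c ∧ i ≤ n + c := by
  by_cases h : ∃ i n : ℕ, φ^[n] θ = φ^[i] α
  · obtain ⟨i₀, n₀, h₀⟩ := h
    refine ⟨i₀ + n₀, fun i n hin => ?_⟩
    have : n + i₀ = i + n₀ := hθ <| by
      change φ^[n + i₀] θ = φ^[i + n₀] θ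
      rw [Function.iterate_add_apply φ i, h₀, ← Function.iterate_add_apply, add_comm n,
        Function.iterate_add_apply, hin, ← Function.iterate_add_apply, add_comm i]
    omega
  · push Not at h
    exact ⟨0, fun i n hin => absurd hin (h i n)⟩

open Classical in
/-- The point equal to `p` at those `φ^n(θ)` whose block label is the successor of an element of
`S`, and to `q` elsewhere. -/
noncomputable def blockPoint (φ : Γ → Γ) (θ : Γ) (p q : X) (S : Set ℕ) : Γ → X := fun γ =>
  if ∃ n : ℕ, φ^[n] θ = γ ∧ ∃ m ∈ S, blockLabel n = m + 1 then p else q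

lemma blockPoint_iterate {θ : Γ} (hθ : Function.Injective fun n : ℕ => φ^[n] θ) {p q : X}
    {S : Set ℕ} {m n : ℕ} (hn : blockLabel n = m + 1) [Decidable (m ∈ S)] :
    blockPoint φ θ p q S (φ^[n] θ) = if m ∈ S then p else q := by
  have : (∃ k : ℕ, φ^[k] θ = φ^[n] θ ∧ ∃ l ∈ S, blockLabel k = l + 1) ↔ m ∈ S := by
    constructor
    · rintro ⟨k, hk, l, hl, hkl⟩
      obtain rfl : k = n := hθ hk
      obtain rfl : m = l := by omega
      exact hl
    · exact fun hm => ⟨n, rfl, m, hm, hn⟩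
  simp only [blockPoint, this]

lemma blockPoint_iterate_ne {θ : Γ} (hθ : Function.Injective fun n : ℕ => φ^[n] θ) {p q : X}
    (hpq : p ≠ q) {S T : Set ℕ} {m n : ℕ} (hm : ¬ (m ∈ S ↔ m ∈ T)) (hn : blockLabel n = m + 1) :
    blockPoint φ θ p q S (φ^[n] θ) ≠ blockPoint φ θ p q T (φ^[n] θ) := by
  classical
  rw [blockPoint_iterate hθ hn, blockPoint_iterate hθ hn]
  by_cases hS : m ∈ S <;> by_cases hT : m ∈ T <;> simp_all [hpq.symm]

lemma blockPoint_eq {θ γ : Γ} {p q : X} (S : Set ℕ)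
    (h : ∀ n : ℕ, φ^[n] θ = γ → blockLabel n = 0) : blockPoint φ θ p q S γ = q := by
  refine if_neg ?_
  rintro ⟨n, hn, m, -, hm⟩
  have := h n hn
  omega

lemma Fdist_blockPoint {θ : Γ} (hθ : Function.Injective fun n : ℕ => φ^[n] θ) {p q : X}
    (hpq : p ≠ q) {S T : Set ℕ} (hST : S ≠ T) {d : (Γ → X) → (Γ → X) → ℝ} {ε : ℝ}
    (hε : ∀ u v, d u v < ε → u θ = v θ) :
    Fdist d (genShift φ) (blockPoint φ θ p q S) (blockPoint φ θ p q T) ε = 0 := by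
  obtain ⟨m, hm⟩ : ∃ m, ¬ (m ∈ S ↔ m ∈ T) := by
    by_contra! h
    exact hST (Set.ext h)
  refine Fdist_eq_zero_of_frequently fun δ hδ => (frequently_block (m + 1) 0 hδ).mono ?_
  rintro N ⟨M, hMN, hblock⟩
  refine le_trans (Nat.cast_le.mpr (xiCount_le_of_forall fun i hMi hiN hlt => ?_))
    (by simpa using hMN)
  have := hε _ _ hlt
  rw [genShift_iterate_apply, genShift_iterate_apply] at this
  exact blockPoint_iterate_ne hθ hpq hm (hblock i hMi hiN) this

variable [TopologicalSpace X] [DiscreteTopology X] [Finite X] {d : (Γ → X) → (Γ → X) → ℝ}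

lemma not_distScrambled1_of_quasiPeriodic (hd : IsCompatibleMetric (Γ → X) d)
    (h : ∀ α, QuasiPeriodic φ α) (x y : Γ → X) : ¬ DistScrambled1 d (genShift φ) x y := by
  rintro ⟨⟨s, hs, hF⟩, hFstar⟩
  obtain ⟨D, hD⟩ := hd.exists_finset_agree hs
  obtain ⟨E, hE, hDE⟩ := exists_finite_agree_of_quasiPeriodic (X := X) h D
  obtain ⟨t, ht, htE⟩ := hd.exists_forall_agree hE
  obtain ⟨i, hi⟩ := exists_lt_of_FdistStar_ne_zero (by rw [hFstar t ht]; exact one_ne_zero)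
  have : Fdist d (genShift φ) x y s = 1 :=
    Fdist_eq_one_of_forall_ge fun j hj => hD _ _ (hDE x y i (htE _ _ hi) j hj)
  exact one_ne_zero (this.symm.trans hF)

lemma FdistStar_blockPoint (hd : IsCompatibleMetric (Γ → X) d) {θ : Γ}
    (hθ : Function.Injective fun n : ℕ => φ^[n] θ) (p q : X) (S T : Set ℕ) {s : ℝ} (hs : 0 < s) :
    FdistStar d (genShift φ) (blockPoint φ θ p q S) (blockPoint φ θ p q T) s = 1 := by
  obtain ⟨D, hD⟩ := hd.exists_finset_agree hs
  choose c hc using exists_le_add_of_iterate_eq hθ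
  set C := D.sup c
  refine FdistStar_eq_one_of_frequently fun δ hδ => (frequently_block 0 (2 * C) hδ).mono ?_
  rintro N ⟨M, hMN, hblock⟩
  have hcount : (N - C) - (M + C) ≤
      xiCount d (genShift φ) (blockPoint φ θ p q S) (blockPoint φ θ p q T) s N := by
    refine sub_le_xiCount_of_forall (Nat.sub_le N C) fun i hi hi' => hD _ _ fun α hα => ?_
    have hα' : c α ≤ C := Finset.le_sup hα
    have hlabel (n : ℕ) (hn : φ^[n] θ = φ^[i] α) : blockLabel n = 0 := by
      have := hc α i n hn
      exact hblock n (by omega) (by omega)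
    rw [genShift_iterate_apply, genShift_iterate_apply, blockPoint_eq S hlabel,
      blockPoint_eq T hlabel]
  have hN : N ≤ xiCount d (genShift φ) (blockPoint φ θ p q S) (blockPoint φ θ p q T) s N +
      (M + 2 * C) := by omega
  have hN' : (N : ℝ) ≤ xiCount d (genShift φ) (blockPoint φ θ p q S) (blockPoint φ θ p q T) s N +
      (M + (2 * C : ℕ)) := by exact_mod_cast hN
  linarith

end GenShift

variable {X : Type*} [Fintype X] [TopologicalSpace X] [DiscreteTopology X] [Nontrivial X]
variable {Γ : Type*} [Countable Γ] [Nonempty Γ]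
/-- for any compatible metric `d` on `X^Γ`, `(X^Γ, σ_φ)` is uniform
distributionally chaotic iff `φ` has at least one non-quasi-periodic point. -/
theorem uniformDC_iff_exists_not_quasiPeriodic
    (φ : Γ → Γ)
    (d : (Γ → X) → (Γ → X) → ℝ) (hd : IsCompatibleMetric (Γ → X) d) :
    UniformDC d (genShift (X := X) φ) ↔ ∃ θ : Γ, ¬ QuasiPeriodic φ θ := by
  refine ⟨?_, ?_⟩
  · rintro ⟨A, -, ⟨⟨x, hx, y, hy, hxy⟩, hA⟩, -⟩
    by_contra! h
    exact not_distScrambled1_of_quasiPeriodic hd h x y (hA x hx y hy hxy)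
  · rintro ⟨θ, hθ⟩
    have hinj := injective_iterate_of_not_quasiPeriodic hθ
    obtain ⟨p, q, hpq⟩ := exists_pair_ne X
    obtain ⟨ε, hε, hεθ⟩ := hd.exists_forall_agree (Set.finite_singleton θ)
    have hF {S T : Set ℕ} (hST : S ≠ T) :
        Fdist d (genShift φ) (blockPoint φ θ p q S) (blockPoint φ θ p q T) ε = 0 :=
      Fdist_blockPoint hinj hpq hST fun u v huv => hεθ u v huv θ rfl
    have hbp : Function.Injective (blockPoint φ θ p q) := fun S T h => by
      ext m
      by_contra hm
      obtain ⟨N, M, hMN, hblock⟩ := (frequently_block (m + 1) 1 (δ := 1) one_pos).exists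
      have hMN' : M < N := by
        have : ((M + 1 : ℕ) : ℝ) ≤ N := by simpa using hMN
        exact_mod_cast this
      exact blockPoint_iterate_ne hinj hpq hm (hblock M le_rfl hMN') (by rw [h])
    refine ⟨Set.range (blockPoint φ θ p q), fun hcount => ?_, ⟨?_, ?_⟩, ε, hε, ?_⟩
    · have := hcount.to_subtype
      have : Countable (Set ℕ) := (Equiv.ofInjective _ hbp).injective.countable
      obtain ⟨g, hg⟩ := exists_injective_nat (Set ℕ)
      exact Function.cantor_injective g hg
    · exact ⟨_, ⟨∅, rfl⟩, _, ⟨Set.univ, rfl⟩, hbp.ne Set.empty_ne_univ⟩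
    · rintro _ ⟨S, rfl⟩ _ ⟨T, rfl⟩ hne
      exact ⟨⟨ε, hε, hF (ne_of_apply_ne _ hne)⟩, fun s hs =>
        FdistStar_blockPoint hd hinj p q S T hs⟩
    · rintro _ ⟨S, rfl⟩ _ ⟨T, rfl⟩ hne
      exact hF (ne_of_apply_ne _ hne)
end

section
/- If for some (equivalently, any) compatible metric d on X^Γ the generalized shift dynamical system (X^Γ, σ_φ) is dense distributional chaotic, then φ : Γ → Γ has no periodic point. -/
open Filter Topology

variable {X : Type*} [Fintype X] [TopologicalSpace X] [DiscreteTopology X] [Nontrivial X]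
variable {Γ : Type*} [Countable Γ] [Nonempty Γ]
theorem genShift_iterate {X Γ : Type*} (φ : Γ → Γ) (n : ℕ) (x : Γ → X) (α : Γ) :
    (genShift φ)^[n] x α = x (φ^[n] α) := by
  induction n generalizing x with
  | zero => rfl
  | succ n ih => rw [Function.iterate_succ_apply, ih, Function.iterate_succ_apply']; rfl

/-- A continuous map from a compact metrizable space to a discrete space identifies points that
are close enough for a given compatible metric. -/
theorem IsCompatibleMetric.exists_forall_lt_imp_eq {Y Z : Type*} [t : TopologicalSpace Y]
    [CompactSpace Y] [TopologicalSpace Z] [DiscreteTopology Z] {d : Y → Y → ℝ}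
    (hd : IsCompatibleMetric Y d) {g : Y → Z} (hg : Continuous g) :
    ∃ s > 0, ∀ u v, d u v < s → g u = g v := by
  obtain ⟨m, hm, hdist⟩ := hd
  subst hm
  obtain ⟨s, hs, h⟩ := lebesgue_number_lemma_of_metric (s := Set.univ) (c := fun z => g ⁻¹' {z})
    isCompact_univ (fun z => (isOpen_discrete {z}).preimage hg) fun y _ => by simp
  refine ⟨s, hs, fun u v huv => ?_⟩
  obtain ⟨z, hz⟩ := h u (Set.mem_univ u)
  have hu : g u = z := hz (Metric.mem_ball_self hs)
  have hv : g v = z := hz (by rw [Metric.mem_ball', hdist]; exact huv)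
  rw [hu, hv]

theorem le_mul_count_dvd {p : ℕ} (hp : 0 < p) (n : ℕ) : n ≤ p * n.count (p ∣ ·) := by
  have h := Nat.count_modEq_card n hp 0
  simp only [Nat.modEq_zero_iff_dvd, Nat.zero_mod] at h
  rw [h]
  have := Nat.div_add_mod n p
  have := Nat.mod_lt n hp
  split_ifs <;> grind

/-- If `x` and `y` stay `t`-apart at all multiples of `p`, their upper distribution at `t` is at
most `1 - 1 / p`. -/
theorem FdistStar_le {Y : Type*} {d : Y → Y → ℝ} {f : Y → Y} {x y : Y} {t : ℝ} {p : ℕ}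
    (hp : 0 < p) (h : ∀ i, p ∣ i → t ≤ d (f^[i] x) (f^[i] y)) :
    FdistStar d f x y t ≤ 1 - 1 / p := by
  refine limsup_le_of_le (isCoboundedUnder_le_of_le atTop (x := 0) fun n => by positivity) ?_
  filter_upwards [eventually_gt_atTop 0] with n hn
  have hcount : xiCount d f x y t n + n.count (p ∣ ·) ≤ n := by
    have hsub : xiCount d f x y t n ≤ ((Finset.range n).filter fun i => ¬ p ∣ i).card := by
      rw [← Set.ncard_coe_finset]
      refine Set.ncard_le_ncard (fun i hi => ?_) (Finset.finite_toSet _)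
      simpa using ⟨hi.1, fun hdvd => (h i hdvd).not_gt hi.2⟩
    have := Finset.card_filter_add_card_filter_not (s := Finset.range n) (fun i => p ∣ i)
    rw [Finset.card_range] at this
    rw [Nat.count_eq_card_filter_range]
    omega
  have hcount' : (xiCount d f x y t n : ℝ) + n.count (p ∣ ·) ≤ n := by exact_mod_cast hcount
  have hmul : (n : ℝ) ≤ p * n.count (p ∣ ·) := by exact_mod_cast le_mul_count_dvd hp n
  have hp' : (0 : ℝ) < p := by exact_mod_cast hp
  have hn' : (0 : ℝ) < n := by exact_mod_cast hn
  have hdiv : (n : ℝ) / p ≤ n.count (p ∣ ·) := by rwa [div_le_iff₀' hp']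
  rw [div_le_iff₀ hn']
  calc (xiCount d f x y t n : ℝ) ≤ n - n / p := by linarith
    _ = (1 - 1 / p) * n := by ring

/-- if `(X^Γ, σ_φ)` is dense distributionally chaotic for a compatible metric
`d`, then `φ` has no periodic point. -/
theorem no_periodicPt_of_denseDC
    (φ : Γ → Γ)
    (d : (Γ → X) → (Γ → X) → ℝ) (hd : IsCompatibleMetric (Γ → X) d)
    (h : DenseDC d (genShift (X := X) φ)) :
    ∀ θ : Γ, ¬ PeriodicPt φ θ := by
  rintro θ ⟨p, hp, hθ⟩
  obtain ⟨A, -, hA, ⟨-, hscr⟩, -⟩ := h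
  obtain ⟨a, b, hab⟩ := exists_pair_ne X
  have hcont : Continuous fun x : Γ → X => x θ := continuous_apply θ
  have hmeet (c : X) : ∃ x ∈ A, x θ = c :=
    hA.exists_mem_open ((isOpen_discrete {c}).preimage hcont) ⟨fun _ => c, rfl⟩
  obtain ⟨x, hxA, rfl⟩ := hmeet a
  obtain ⟨y, hyA, rfl⟩ := hmeet b
  obtain ⟨s, hs, hsep⟩ := hd.exists_forall_lt_imp_eq hcont
  have hle : FdistStar d (genShift φ) x y s ≤ 1 - 1 / p := by
    refine FdistStar_le hp ?_
    rintro _ ⟨k, rfl⟩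
    by_contra! hlt
    have heq := hsep _ _ hlt
    have hfix : φ^[p * k] θ = θ := by
      rw [Function.iterate_mul]
      exact Function.iterate_fixed hθ k
    rw [genShift_iterate, genShift_iterate, hfix] at heq
    exact hab heq
  rw [(hscr x hxA y hyA fun hxy => hab (congrFun hxy θ)).2 s hs] at hle
  have : (0 : ℝ) < 1 / p := by positivity
  linarith
end
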